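/- The mixture model of three product distributions on {0,1}^3 contains no probability distribution with four modes. Equivalently, no convex combination of three product distributions on {0,1}^3 has the even-weight (or odd-weight) vectors as its set of modes. -/

import Mathlib

/-- Checkerboard inequalities along the twelve edges of the cube. -/
def Good (a a' b b' c c' : Fin 3 → ℝ) (s : ℝ) : Prop :=
  (0 < s * ∑ j, (a j - a' j) * b j * c j ∧ s * ∑ j, (a j - a' j) * b j * c' j < 0 ∧
   s * ∑ j, (a j - a' j) * b' j * c j < 0 ∧ 0 < s * ∑ j, (a j - a' j) * b' j * c' j) ∧
  (0 < s * ∑ j, (b j - b' j) * a j * c j ∧ s * ∑ j, (b j - b' j) * a j * c' j < 0 ∧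
   s * ∑ j, (b j - b' j) * a' j * c j < 0 ∧ 0 < s * ∑ j, (b j - b' j) * a' j * c' j) ∧
  (0 < s * ∑ j, (c j - c' j) * a j * b j ∧ s * ∑ j, (c j - c' j) * a j * b' j < 0 ∧
   s * ∑ j, (c j - c' j) * a' j * b j < 0 ∧ 0 < s * ∑ j, (c j - c' j) * a' j * b' j)

lemma Good.swap12 {a a' b b' c c' : Fin 3 → ℝ} {s : ℝ} (h : Good a a' b b' c c' s) :
    Good b b' a a' c c' s := by
  simp only [Good, Fin.sum_univ_three] at h ⊢
  obtain ⟨⟨h1, h2, h3, h4⟩, ⟨h5, h6, h7, h8⟩, h9, h10, h11, h12⟩ := h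
  refine ⟨⟨?_, ?_, ?_, ?_⟩, ⟨?_, ?_, ?_, ?_⟩, ?_, ?_, ?_, ?_⟩ <;> linarith

lemma Good.swap23 {a a' b b' c c' : Fin 3 → ℝ} {s : ℝ} (h : Good a a' b b' c c' s) :
    Good a a' c c' b b' s := by
  simp only [Good, Fin.sum_univ_three] at h ⊢
  obtain ⟨⟨h1, h2, h3, h4⟩, ⟨h5, h6, h7, h8⟩, h9, h10, h11, h12⟩ := h
  refine ⟨⟨?_, ?_, ?_, ?_⟩, ⟨?_, ?_, ?_, ?_⟩, ?_, ?_, ?_, ?_⟩ <;> linarith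

lemma Good.flip {a a' b b' c c' : Fin 3 → ℝ} {s : ℝ} (h : Good a a' b b' c c' s) :
    Good a' a b b' c c' (-s) := by
  simp only [Good, Fin.sum_univ_three] at h ⊢
  obtain ⟨⟨h1, h2, h3, h4⟩, ⟨h5, h6, h7, h8⟩, h9, h10, h11, h12⟩ := h
  refine ⟨⟨?_, ?_, ?_, ?_⟩, ⟨?_, ?_, ?_, ?_⟩, ?_, ?_, ?_, ?_⟩ <;> linarith

lemma Good.not_const {a a' b b' c c' : Fin 3 → ℝ} {s : ℝ} (h : Good a a' b b' c c' s)
    (hb : ∀ j, 0 ≤ b j) (hc : ∀ j, 0 ≤ c j) (hc' : ∀ j, 0 ≤ c' j)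
    (ha : ∀ j, 0 ≤ a j - a' j) : False := by
  obtain ⟨⟨h1, h2, -, -⟩, -⟩ := h
  have e1 : 0 ≤ ∑ j, (a j - a' j) * b j * c j :=
    Finset.sum_nonneg fun j _ => mul_nonneg (mul_nonneg (ha j) (hb j)) (hc j)
  have e2 : 0 ≤ ∑ j, (a j - a' j) * b j * c' j :=
    Finset.sum_nonneg fun j _ => mul_nonneg (mul_nonneg (ha j) (hb j)) (hc' j)
  have := pos_of_mul_pos_left h1 e1
  exact absurd (mul_nonneg this.le e2) (not_le.2 h2)

lemma Good.not_const2 {a a' b b' c c' : Fin 3 → ℝ} {s : ℝ} (h : Good a a' b b' c c' s)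
    (hc : ∀ j, 0 ≤ c j) (hc' : ∀ j, 0 ≤ c' j)
    (hab : ∀ j, 0 ≤ (a j - a' j) * (b j - b' j)) : False := by
  obtain ⟨⟨h1, h2, h3, h4⟩, -⟩ := h
  have e1 : 0 ≤ ∑ j, (a j - a' j) * (b j - b' j) * c j :=
    Finset.sum_nonneg fun j _ => mul_nonneg (hab j) (hc j)
  have e2 : 0 ≤ ∑ j, (a j - a' j) * (b j - b' j) * c' j :=
    Finset.sum_nonneg fun j _ => mul_nonneg (hab j) (hc' j)
  have f1 : 0 < s * ∑ j, (a j - a' j) * (b j - b' j) * c j := by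
    simp only [Fin.sum_univ_three] at h1 h3 ⊢
    linarith
  have f2 : s * ∑ j, (a j - a' j) * (b j - b' j) * c' j < 0 := by
    simp only [Fin.sum_univ_three] at h2 h4 ⊢
    linarith
  have := pos_of_mul_pos_left f1 e1
  exact absurd (mul_nonneg this.le e2) (not_le.2 f2)

lemma core_ineq {X P Q c1 c1' c2 c2' c3 c3' : ℝ} (hX : 0 ≤ X) (hP : 0 ≤ P) (hQ : 0 ≤ Q)
    (h1 : 0 ≤ c1) (h2 : 0 ≤ c2) (h3' : 0 ≤ c3') (h11 : c1 ≤ c1') (h33 : c3' ≤ c3)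
    (hA : P * c2 + Q * c3 < X * c1) (hB : X * c1' < P * c2' + Q * c3') :
    c1' * c2 < c1 * c2' := by
  have hc3 : 0 ≤ c3 := h3'.trans h33
  have hpos : 0 < X * c1 := lt_of_le_of_lt (by positivity) hA
  have hc1 : 0 < c1 := pos_of_mul_pos_right hpos hX
  by_contra hcon
  push Not at hcon
  have k1 := mul_lt_mul_of_pos_left hA (lt_of_lt_of_le hc1 h11)
  have k2 := mul_lt_mul_of_pos_left hB hc1
  have k3 := mul_le_mul_of_nonneg_left hcon hP
  have k4 : c1 * c3' ≤ c1' * c3 := mul_le_mul h11 h33 h3' (h1.trans h11)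
  have k5 := mul_le_mul_of_nonneg_left k4 hQ
  nlinarith

lemma Good.final {a a' b b' c c' : Fin 3 → ℝ} {s : ℝ} (h : Good a a' b b' c c' s)
    (ha : ∀ j, 0 ≤ a j) (ha' : ∀ j, 0 ≤ a' j) (hb : ∀ j, 0 ≤ b j) (hb' : ∀ j, 0 ≤ b' j)
    (hc : ∀ j, 0 ≤ c j) (hc' : ∀ j, 0 ≤ c' j) (i j k : Fin 3)
    (hsum : ∀ f : Fin 3 → ℝ, ∑ t, f t = f i + f j + f k)
    (a1 : a' i ≤ a i) (a2 : a j ≤ a' j) (a3 : a k ≤ a' k)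
    (b1 : b i ≤ b' i) (b2 : b' j ≤ b j) (b3 : b k ≤ b' k)
    (c1 : c i ≤ c' i) (c2 : c j ≤ c' j) (c3 : c' k ≤ c k) : False := by
  obtain ⟨⟨h1, h2, h3, h4⟩, ⟨h5, h6, h7, h8⟩, -⟩ := h
  simp only [hsum] at h1 h2 h3 h4 h5 h6 h7 h8
  rcases lt_trichotomy s 0 with hs | hs | hs
  · have g3 := pos_of_mul_neg_right h3 hs.le
    have g4 := neg_of_mul_pos_right h4 hs.le
    have g7 := pos_of_mul_neg_right h7 hs.le
    have g8 := neg_of_mul_pos_right h8 hs.le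
    have r1 := core_ineq (X := (a i - a' i) * b' i) (P := (a' j - a j) * b' j)
      (Q := (a' k - a k) * b' k) (mul_nonneg (by linarith) (hb' i))
      (mul_nonneg (by linarith) (hb' j)) (mul_nonneg (by linarith) (hb' k))
      (hc i) (hc j) (hc' k) c1 c3 (by linarith) (c2' := c' j) (by linarith)
    have r2 := core_ineq (X := (b j - b' j) * a' j) (P := (b' i - b i) * a' i)
      (Q := (b' k - b k) * a' k) (mul_nonneg (by linarith) (ha' j))
      (mul_nonneg (by linarith) (ha' i)) (mul_nonneg (by linarith) (ha' k))
      (hc j) (hc i) (hc' k) c2 c3 (by linarith) (c2' := c' i) (by linarith)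
    linarith
  · simp [hs] at h1
  · have g3 := pos_of_mul_pos_right h1 hs.le
    have g4 := neg_of_mul_neg_right h2 hs.le
    have g7 := pos_of_mul_pos_right h5 hs.le
    have g8 := neg_of_mul_neg_right h6 hs.le
    have r1 := core_ineq (X := (a i - a' i) * b i) (P := (a' j - a j) * b j)
      (Q := (a' k - a k) * b k) (mul_nonneg (by linarith) (hb i))
      (mul_nonneg (by linarith) (hb j)) (mul_nonneg (by linarith) (hb k))
      (hc i) (hc j) (hc' k) c1 c3 (by linarith) (c2' := c' j) (by linarith)
    have r2 := core_ineq (X := (b j - b' j) * a j) (P := (b' i - b i) * a i)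
      (Q := (b' k - b k) * a k) (mul_nonneg (by linarith) (ha j))
      (mul_nonneg (by linarith) (ha i)) (mul_nonneg (by linarith) (ha k))
      (hc j) (hc i) (hc' k) c2 c3 (by linarith) (c2' := c' i) (by linarith)
    linarith

/-- `i` is the odd one out: `d i` prefers the first slot, all others the second. -/
def Odd1 (d d' : Fin 3 → ℝ) (i : Fin 3) : Prop := d' i ≤ d i ∧ ∀ k, k ≠ i → d k ≤ d' k

lemma odd_cases (d d' : Fin 3 → ℝ) :
    (∀ j, 0 ≤ d j - d' j) ∨ (∀ j, 0 ≤ d' j - d j) ∨ (∃ i, Odd1 d d' i) ∨ ∃ i, Odd1 d' d i := by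
  simp only [Odd1, Fin.forall_fin_succ, Fin.exists_fin_succ, sub_nonneg]
  rcases le_total (d 0) (d' 0) with h0 | h0 <;> rcases le_total (d 1) (d' 1) with h1 | h1 <;>
  rcases le_total (d 2) (d' 2) with h2 | h2 <;> simp [h0, h1, h2]

lemma Good.odd {a a' b b' c c' : Fin 3 → ℝ} {s : ℝ} (h : Good a a' b b' c c' s)
    (hb : ∀ j, 0 ≤ b j) (hc : ∀ j, 0 ≤ c j) (hc' : ∀ j, 0 ≤ c' j) :
    (∃ i, Odd1 a a' i) ∨ ∃ i, Odd1 a' a i := by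
  rcases odd_cases a a' with h1 | h1 | h1
  · exact (h.not_const hb hc hc' h1).elim
  · exact (h.flip.not_const hb hc hc' h1).elim
  · exact h1

lemma Good.ne {a a' b b' c c' : Fin 3 → ℝ} {s : ℝ} (h : Good a a' b b' c c' s)
    (hc : ∀ j, 0 ≤ c j) (hc' : ∀ j, 0 ≤ c' j) {i j : Fin 3} (hi : Odd1 a a' i)
    (hj : Odd1 b b' j) : i ≠ j := by
  rintro rfl
  refine h.not_const2 hc hc' fun k => ?_
  by_cases hk : k = i
  · subst hk
    exact mul_nonneg (sub_nonneg.2 hi.1) (sub_nonneg.2 hj.1)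
  · exact mul_nonneg_of_nonpos_of_nonpos (sub_nonpos.2 (hi.2 k hk)) (sub_nonpos.2 (hj.2 k hk))

lemma Good.false3 {a a' b b' c c' : Fin 3 → ℝ} {s : ℝ} (h : Good a a' b b' c c' s)
    (ha : ∀ j, 0 ≤ a j) (ha' : ∀ j, 0 ≤ a' j) (hb : ∀ j, 0 ≤ b j) (hb' : ∀ j, 0 ≤ b' j)
    (hc : ∀ j, 0 ≤ c j) (hc' : ∀ j, 0 ≤ c' j) {i j k : Fin 3}
    (hi : Odd1 a a' i) (hj : Odd1 b b' j) (hk : Odd1 c c' k) : False := by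
  have hij := h.ne hc hc' hi hj
  have hik := h.swap23.ne hb hb' hi hk
  have hjk := h.swap12.swap23.ne ha ha' hj hk
  refine h.final ha ha' hb hb' hc hc' i j k ?_ hi.1 (hi.2 j hij.symm) (hi.2 k hik.symm)
    (hj.2 i hij) hj.1 (hj.2 k hjk.symm) (hk.2 i hik) (hk.2 j hjk) hk.1
  intro f
  rw [Fin.sum_univ_three]
  fin_cases i <;> fin_cases j <;> fin_cases k <;> simp at hij hik hjk ⊢ <;> ring

lemma Good.false2 {a a' b b' c c' : Fin 3 → ℝ} {s : ℝ} (h : Good a a' b b' c c' s)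
    (ha : ∀ j, 0 ≤ a j) (ha' : ∀ j, 0 ≤ a' j) (hb : ∀ j, 0 ≤ b j) (hb' : ∀ j, 0 ≤ b' j)
    (hc : ∀ j, 0 ≤ c j) (hc' : ∀ j, 0 ≤ c' j) {i j : Fin 3}
    (hi : Odd1 a a' i) (hj : Odd1 b b' j) : False := by
  rcases h.swap23.swap12.odd ha hb hb' with ⟨k, hk⟩ | ⟨k, hk⟩
  · exact h.false3 ha ha' hb hb' hc hc' hi hj hk
  · exact h.swap23.swap12.flip.swap12.swap23.false3 ha ha' hb hb' hc' hc hi hj hk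

lemma Good.false1 {a a' b b' c c' : Fin 3 → ℝ} {s : ℝ} (h : Good a a' b b' c c' s)
    (ha : ∀ j, 0 ≤ a j) (ha' : ∀ j, 0 ≤ a' j) (hb : ∀ j, 0 ≤ b j) (hb' : ∀ j, 0 ≤ b' j)
    (hc : ∀ j, 0 ≤ c j) (hc' : ∀ j, 0 ≤ c' j) {i : Fin 3}
    (hi : Odd1 a a' i) : False := by
  rcases h.swap12.odd ha hc hc' with ⟨k, hk⟩ | ⟨k, hk⟩
  · exact h.false2 ha ha' hb hb' hc hc' hi hk
  · exact h.swap12.flip.swap12.false2 ha ha' hb' hb hc hc' hi hk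

lemma Good.false {a a' b b' c c' : Fin 3 → ℝ} {s : ℝ} (h : Good a a' b b' c c' s)
    (ha : ∀ j, 0 ≤ a j) (ha' : ∀ j, 0 ≤ a' j) (hb : ∀ j, 0 ≤ b j) (hb' : ∀ j, 0 ≤ b' j)
    (hc : ∀ j, 0 ≤ c j) (hc' : ∀ j, 0 ≤ c' j) : False := by
  rcases h.odd hb hc hc' with ⟨k, hk⟩ | ⟨k, hk⟩
  · exact h.false1 ha ha' hb hb' hc hc' hk
  · exact h.flip.false1 ha' ha hb hb' hc hc' hk


/-- No convex combination of three product distributions on `{0,1}^3` has the set of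
even-weight vectors, or the set of odd-weight vectors, as its set of modes;
i.e. `M_{3,3}` contains no distribution with four modes. -/
theorem three_mixture_no_four_modes
    (α : Fin 3 → ℝ) (hα0 : ∀ j, 0 ≤ α j) (hα1 : ∑ j, α j = 1)
    (q : Fin 3 → (Fin 3 → Bool) → ℝ)
    (hq : ∀ j, ∃ f : Fin 3 → Bool → ℝ, (∀ i b, 0 ≤ f i b) ∧
      (∀ i, f i false + f i true = 1) ∧ ∀ x, q j x = ∏ i, f i (x i))
    (p : (Fin 3 → Bool) → ℝ) (hp : ∀ x, p x = ∑ j, α j * q j x) :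
    (¬ ∀ x : Fin 3 → Bool,
        (∀ y, hammingDist x y = 1 → p y < p x) ↔
          Even (Finset.univ.filter (fun i => x i = true)).card) ∧
    (¬ ∀ x : Fin 3 → Bool,
        (∀ y, hammingDist x y = 1 → p y < p x) ↔
          Odd (Finset.univ.filter (fun i => x i = true)).card) := by
  choose f hf0 hf1 hfq using hq
  have hval : ∀ u v w : Bool, p ![u, v, w] =
      ∑ j, (α j * f j 0 u) * f j 1 v * f j 2 w := by
    intro u v w
    rw [hp]
    refine Finset.sum_congr rfl fun j _ => ?_
    rw [hfq, Fin.prod_univ_three]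
    simp
    ring
  have key : ∀ s : ℝ, ¬ Good (fun j => α j * f j 0 false) (fun j => α j * f j 0 true)
      (fun j => f j 1 false) (fun j => f j 1 true)
      (fun j => f j 2 false) (fun j => f j 2 true) s := fun s h =>
    h.false (fun j => mul_nonneg (hα0 j) (hf0 _ _ _)) (fun j => mul_nonneg (hα0 j) (hf0 _ _ _))
      (fun j => hf0 _ _ _) (fun j => hf0 _ _ _) (fun j => hf0 _ _ _) (fun j => hf0 _ _ _)
  constructor
  · intro H
    have E : ∀ u v w u' v' w' : Bool,
        Even (Finset.univ.filter (fun i => (![u, v, w] : Fin 3 → Bool) i = true)).card →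
        hammingDist ![u, v, w] ![u', v', w'] = 1 → p ![u', v', w'] < p ![u, v, w] :=
      fun u v w u' v' w' h1 h2 => (H _).2 h1 _ h2
    apply key 1
    have e1 := E false false false true false false (by decide) (by decide)
    have e2 := E false false false false true false (by decide) (by decide)
    have e3 := E false false false false false true (by decide) (by decide)
    have e4 := E false true true true true true (by decide) (by decide)
    have e5 := E false true true false false true (by decide) (by decide)
    have e6 := E false true true false true false (by decide) (by decide)
    have e7 := E true false true true true true (by decide) (by decide)
    have e8 := E true false true false false true (by decide) (by decide)
    have e9 := E true false true true false false (by decide) (by decide)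
    have e10 := E true true false true true true (by decide) (by decide)
    have e11 := E true true false false true false (by decide) (by decide)
    have e12 := E true true false true false false (by decide) (by decide)
    simp only [hval, Fin.sum_univ_three] at e1 e2 e3 e4 e5 e6 e7 e8 e9 e10 e11 e12
    simp only [Good, Fin.sum_univ_three]
    refine ⟨⟨?_, ?_, ?_, ?_⟩, ⟨?_, ?_, ?_, ?_⟩, ?_, ?_, ?_, ?_⟩ <;> linarith
  · intro H
    have E : ∀ u v w u' v' w' : Bool,
        Odd (Finset.univ.filter (fun i => (![u, v, w] : Fin 3 → Bool) i = true)).card →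
        hammingDist ![u, v, w] ![u', v', w'] = 1 → p ![u', v', w'] < p ![u, v, w] :=
      fun u v w u' v' w' h1 h2 => (H _).2 h1 _ h2
    apply key (-1)
    have e1 := E true false false false false false (by decide) (by decide)
    have e2 := E false true false false false false (by decide) (by decide)
    have e3 := E false false true false false false (by decide) (by decide)
    have e4 := E true true true false true true (by decide) (by decide)
    have e5 := E false false true false true true (by decide) (by decide)
    have e6 := E false true false false true true (by decide) (by decide)
    have e7 := E true true true true false true (by decide) (by decide)
    have e8 := E false false true true false true (by decide) (by decide)
    have e9 := E true false false true false true (by decide) (by decide)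
    have e10 := E true true true true true false (by decide) (by decide)
    have e11 := E false true false true true false (by decide) (by decide)
    have e12 := E true false false true true false (by decide) (by decide)
    simp only [hval, Fin.sum_univ_three] at e1 e2 e3 e4 e5 e6 e7 e8 e9 e10 e11 e12
    simp only [Good, Fin.sum_univ_three]
    refine ⟨⟨?_, ?_, ?_, ?_⟩, ⟨?_, ?_, ?_, ?_⟩, ?_, ?_, ?_, ?_⟩ <;> linarith
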